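/- Let (f,g,ρ) be a warped Berger solution of Ricci flow on S^1×S^3 defined on [0,T) satisfying Assumption A. Then there exists a uniform constant C < ∞ such that |∂_t(f(ξ,t)²)| ≤ C and |∂_t(g(ξ,t)²)| ≤ C for all (ξ,t) ∈ S^1×[0,T); consequently, for every ξ ∈ S^1 the limits lim_{t↗T} f(ξ,t) and lim_{t↗T} g(ξ,t) exist, so the solution has a well-defined profile at the singular time. -/

import Mathlib

open Real Set Filter Topology

noncomputable section

/-- Partial derivative in the first (spatial, `ξ`) variable. -/
def pd1 (φ : ℝ → ℝ → ℝ) (ξ t : ℝ) : ℝ := deriv (fun x => φ x t) ξ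

/-- Partial derivative in the second (time) variable: `φ_t`. -/
def pdt (φ : ℝ → ℝ → ℝ) (ξ t : ℝ) : ℝ := deriv (fun τ => φ ξ τ) t

/-- Derivative with respect to arclength `s` (where `ds = ρ dξ`): `φ_s := ρ⁻¹ ∂_ξ φ`. -/
def Ds (ρ φ : ℝ → ℝ → ℝ) (ξ t : ℝ) : ℝ := pd1 φ ξ t / ρ ξ t

/-- Sectional curvature `κ₁₂ = κ₃₁ = f²/g⁴ − f_s g_s/(f g)`. -/
def k12 (ρ f g : ℝ → ℝ → ℝ) (ξ t : ℝ) : ℝ :=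
  (f ξ t) ^ 2 / (g ξ t) ^ 4 - Ds ρ f ξ t * Ds ρ g ξ t / (f ξ t * g ξ t)

/-- Sectional curvature `κ₃₁ = κ₁₂`. -/
def k31 (ρ f g : ℝ → ℝ → ℝ) (ξ t : ℝ) : ℝ :=
  (f ξ t) ^ 2 / (g ξ t) ^ 4 - Ds ρ f ξ t * Ds ρ g ξ t / (f ξ t * g ξ t)

/-- Sectional curvature `κ₂₃ = (4g² − 3f²)/g⁴ − g_s²/g²`. -/
def k23 (ρ f g : ℝ → ℝ → ℝ) (ξ t : ℝ) : ℝ :=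
  (4 * (g ξ t) ^ 2 - 3 * (f ξ t) ^ 2) / (g ξ t) ^ 4 - (Ds ρ g ξ t) ^ 2 / (g ξ t) ^ 2

/-- Sectional curvature `κ₀₁ = −f_ss/f`. -/
def k01 (ρ f : ℝ → ℝ → ℝ) (ξ t : ℝ) : ℝ := -(Ds ρ (Ds ρ f) ξ t) / f ξ t

/-- Sectional curvature `κ₀₂ = κ₀₃ = −g_ss/g`. -/
def k02 (ρ g : ℝ → ℝ → ℝ) (ξ t : ℝ) : ℝ := -(Ds ρ (Ds ρ g) ξ t) / g ξ t

/-- Scalar curvature `R = κ₀₁ + 2κ₀₂ + 2κ₁₂ + κ₂₃`. -/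
def scalR (ρ f g : ℝ → ℝ → ℝ) (ξ t : ℝ) : ℝ :=
  k01 ρ f ξ t + 2 * k02 ρ g ξ t + 2 * k12 ρ f g ξ t + k23 ρ f g ξ t

/-- `M(ξ,t) := min {f(ξ,t), g(ξ,t)}`. -/
def M (f g : ℝ → ℝ → ℝ) (ξ t : ℝ) : ℝ := min (f ξ t) (g ξ t)

/-- `M̌(t) := min_{ξ ∈ S¹} M(ξ,t)`. -/
def Mcheck (f g : ℝ → ℝ → ℝ) (t : ℝ) : ℝ := ⨅ ξ : ℝ, M f g ξ t

/-- A warped Berger solution of Ricci flow on `S¹ × S³` with (finite) existence time `T`: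
smooth positive `2π`-periodic-in-`ξ` functions `f, g, ρ` on `S¹ × [0,T)` satisfying
  `f_t = f_ss + 2 (g_s/g) f_s − 2 f³/g⁴`,
  `g_t = g_ss + (f_s/f + g_s/g) g_s + 2 (f² − 2g²)/g³`,
  `(log ρ)_t = f_ss/f + 2 g_ss/g`. -/
structure WarpedBerger (T : ℝ) (f g ρ : ℝ → ℝ → ℝ) : Prop where
  T_pos : 0 < T
  f_pos : ∀ ξ t : ℝ, 0 ≤ t → t < T → 0 < f ξ t
  g_pos : ∀ ξ t : ℝ, 0 ≤ t → t < T → 0 < g ξ t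
  ρ_pos : ∀ ξ t : ℝ, 0 ≤ t → t < T → 0 < ρ ξ t
  f_per : ∀ ξ t : ℝ, f (ξ + 2 * π) t = f ξ t
  g_per : ∀ ξ t : ℝ, g (ξ + 2 * π) t = g ξ t
  ρ_per : ∀ ξ t : ℝ, ρ (ξ + 2 * π) t = ρ ξ t
  smooth : ContDiffOn ℝ (⊤ : ℕ∞)
      (fun p : ℝ × ℝ => (f p.1 p.2, g p.1 p.2, ρ p.1 p.2)) (Set.univ ×ˢ Set.Ico 0 T)
  eq_f : ∀ ξ t : ℝ, 0 < t → t < T →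
    pdt f ξ t = Ds ρ (Ds ρ f) ξ t + 2 * (Ds ρ g ξ t / g ξ t) * Ds ρ f ξ t
      - 2 * (f ξ t) ^ 3 / (g ξ t) ^ 4
  eq_g : ∀ ξ t : ℝ, 0 < t → t < T →
    pdt g ξ t = Ds ρ (Ds ρ g) ξ t
      + (Ds ρ f ξ t / f ξ t + Ds ρ g ξ t / g ξ t) * Ds ρ g ξ t
      + 2 * ((f ξ t) ^ 2 - 2 * (g ξ t) ^ 2) / (g ξ t) ^ 3
  eq_ρ : ∀ ξ t : ℝ, 0 < t → t < T →
    pdt (fun x τ => Real.log (ρ x τ)) ξ t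
      = Ds ρ (Ds ρ f) ξ t / f ξ t + 2 * (Ds ρ (Ds ρ g) ξ t / g ξ t)

/-- The Ricci curvature blows up as `t ↗ T`:
`limsup_{t↗T} max_ξ (|κ₀₁+2κ₁₂| + |κ₀₁+2κ₀₂| + |κ₀₂+κ₁₂+κ₂₃|) = ∞`, where the three
displayed quantities are the diagonal components of the Ricci tensor. -/
def RicciBlowup (T : ℝ) (f g ρ : ℝ → ℝ → ℝ) : Prop :=
  ∀ K : ℝ, ∀ t₀ : ℝ, 0 ≤ t₀ → t₀ < T → ∃ ξ t : ℝ, t₀ < t ∧ t < T ∧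
    K < |k01 ρ f ξ t + 2 * k12 ρ f g ξ t| + |k01 ρ f ξ t + 2 * k02 ρ g ξ t|
        + |k02 ρ g ξ t + k12 ρ f g ξ t + k23 ρ f g ξ t|

/-- Assumption A: `f ≤ g` at `t = 0`; `(min_ξ R(ξ,0))·(max_ξ g(ξ,0)²) > −3`;
and the Ricci curvature blows up at the finite time `T`. -/
structure AssumptionA (T : ℝ) (f g ρ : ℝ → ℝ → ℝ) extends WarpedBerger T f g ρ : Prop where
  init_order : ∀ ξ : ℝ, f ξ 0 ≤ g ξ 0
  init_scalar : (⨅ ξ : ℝ, scalR ρ f g ξ 0) * (⨆ ξ : ℝ, (g ξ 0) ^ 2) > -3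
  ricci_blowup : RicciBlowup T f g ρ


def Nice (T : ℝ) (φ : ℝ → ℝ → ℝ) : Prop :=
  ContDiffOn ℝ (⊤ : ℕ∞) (fun z : ℝ × ℝ => φ z.1 z.2) (Set.univ ×ˢ Set.Ico 0 T)

def Sd (T : ℝ) (ρ φ ψ : ℝ → ℝ → ℝ) : Prop :=
  ∀ ξ t, 0 < t → t < T → HasDerivAt (fun x => φ x t) (ψ ξ t * ρ ξ t) ξ

def Td (T : ℝ) (φ ψ : ℝ → ℝ → ℝ) : Prop :=
  ∀ ξ t, 0 < t → t < T → HasDerivAt (fun τ => φ ξ τ) (ψ ξ t) t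

section calculus
variable {T : ℝ} {ρ φ ψ φ' ψ' : ℝ → ℝ → ℝ}

theorem Sd.add (h1 : Sd T ρ φ φ') (h2 : Sd T ρ ψ ψ') :
    Sd T ρ (fun ξ t => φ ξ t + ψ ξ t) (fun ξ t => φ' ξ t + ψ' ξ t) := by
  intro ξ t a b
  refine ((h1 ξ t a b).fun_add (h2 ξ t a b)).congr_deriv ?_
  beta_reduce
  ring

theorem Sd.sub (h1 : Sd T ρ φ φ') (h2 : Sd T ρ ψ ψ') :
    Sd T ρ (fun ξ t => φ ξ t - ψ ξ t) (fun ξ t => φ' ξ t - ψ' ξ t) := by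
  intro ξ t a b
  refine ((h1 ξ t a b).fun_sub (h2 ξ t a b)).congr_deriv ?_
  beta_reduce
  ring

theorem Sd.mul (h1 : Sd T ρ φ φ') (h2 : Sd T ρ ψ ψ') :
    Sd T ρ (fun ξ t => φ ξ t * ψ ξ t) (fun ξ t => φ' ξ t * ψ ξ t + φ ξ t * ψ' ξ t) := by
  intro ξ t a b
  refine ((h1 ξ t a b).fun_mul (h2 ξ t a b)).congr_deriv ?_
  beta_reduce
  ring

theorem Sd.div (h1 : Sd T ρ φ φ') (h2 : Sd T ρ ψ ψ')
    (h0 : ∀ ξ t, 0 < t → t < T → ψ ξ t ≠ 0) :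
    Sd T ρ (fun ξ t => φ ξ t / ψ ξ t)
      (fun ξ t => (φ' ξ t * ψ ξ t - φ ξ t * ψ' ξ t) / (ψ ξ t) ^ 2) := by
  intro ξ t a b
  refine ((h1 ξ t a b).fun_div (h2 ξ t a b) (h0 ξ t a b)).congr_deriv ?_
  beta_reduce
  ring

theorem Sd.pow (h1 : Sd T ρ φ φ') (n : ℕ) :
    Sd T ρ (fun ξ t => φ ξ t ^ n) (fun ξ t => n * φ ξ t ^ (n - 1) * φ' ξ t) := by
  intro ξ t a b
  refine ((h1 ξ t a b).fun_pow n).congr_deriv ?_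
  beta_reduce
  ring

theorem Sd.cmul (c : ℝ) (h1 : Sd T ρ φ φ') :
    Sd T ρ (fun ξ t => c * φ ξ t) (fun ξ t => c * φ' ξ t) := by
  intro ξ t a b
  refine ((h1 ξ t a b).const_mul c).congr_deriv ?_
  beta_reduce
  ring

theorem Sd.log (h1 : Sd T ρ φ φ') (h0 : ∀ ξ t, 0 < t → t < T → φ ξ t ≠ 0) :
    Sd T ρ (fun ξ t => Real.log (φ ξ t)) (fun ξ t => φ' ξ t / φ ξ t) := by
  intro ξ t a b
  refine ((h1 ξ t a b).log (h0 ξ t a b)).congr_deriv ?_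
  beta_reduce
  ring

theorem Sd.congr (h1 : Sd T ρ φ φ') (h : ∀ ξ t, 0 < t → t < T → φ' ξ t = ψ' ξ t) :
    Sd T ρ φ ψ' := by
  intro ξ t a b
  rw [← h ξ t a b]; exact h1 ξ t a b

theorem Td.add (h1 : Td T φ φ') (h2 : Td T ψ ψ') :
    Td T (fun ξ t => φ ξ t + ψ ξ t) (fun ξ t => φ' ξ t + ψ' ξ t) :=
  fun ξ t a b => (h1 ξ t a b).fun_add (h2 ξ t a b)

theorem Td.sub (h1 : Td T φ φ') (h2 : Td T ψ ψ') :
    Td T (fun ξ t => φ ξ t - ψ ξ t) (fun ξ t => φ' ξ t - ψ' ξ t) :=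
  fun ξ t a b => (h1 ξ t a b).fun_sub (h2 ξ t a b)

theorem Td.mul (h1 : Td T φ φ') (h2 : Td T ψ ψ') :
    Td T (fun ξ t => φ ξ t * ψ ξ t) (fun ξ t => φ' ξ t * ψ ξ t + φ ξ t * ψ' ξ t) :=
  fun ξ t a b => (h1 ξ t a b).fun_mul (h2 ξ t a b)

theorem Td.pow (h1 : Td T φ φ') (n : ℕ) :
    Td T (fun ξ t => φ ξ t ^ n) (fun ξ t => n * φ ξ t ^ (n - 1) * φ' ξ t) :=
  fun ξ t a b => (h1 ξ t a b).fun_pow n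

theorem Td.cmul (c : ℝ) (h1 : Td T φ φ') :
    Td T (fun ξ t => c * φ ξ t) (fun ξ t => c * φ' ξ t) :=
  fun ξ t a b => (h1 ξ t a b).const_mul c

theorem Td.log (h1 : Td T φ φ') (h0 : ∀ ξ t, 0 < t → t < T → φ ξ t ≠ 0) :
    Td T (fun ξ t => Real.log (φ ξ t)) (fun ξ t => φ' ξ t / φ ξ t) :=
  fun ξ t a b => (h1 ξ t a b).log (h0 ξ t a b)

theorem Td.congr (h1 : Td T φ φ') (h : ∀ ξ t, 0 < t → t < T → φ' ξ t = ψ' ξ t) :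
    Td T φ ψ' := by
  intro ξ t a b
  rw [← h ξ t a b]; exact h1 ξ t a b

theorem uds (T : ℝ) (hT : 0 < T) : UniqueDiffOn ℝ ((Set.univ : Set ℝ) ×ˢ Set.Ico (0:ℝ) T) :=
  uniqueDiffOn_univ.prod (uniqueDiffOn_Ico 0 T)

theorem Nice.sderiv (hT : 0 < T) (h : Nice T φ) (ξ t : ℝ) (a : 0 ≤ t) (b : t < T) :
    HasDerivAt (fun x => φ x t)
      (fderivWithin ℝ (fun z : ℝ × ℝ => φ z.1 z.2) (Set.univ ×ˢ Set.Ico 0 T) (ξ, t) (1, 0)) ξ := by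
  have hd : DifferentiableWithinAt ℝ (fun z : ℝ × ℝ => φ z.1 z.2) (Set.univ ×ˢ Set.Ico 0 T) (ξ, t) :=
    (h (ξ, t) ⟨trivial, a, b⟩).differentiableWithinAt (by simp)
  have h2 : HasDerivWithinAt (fun x : ℝ => (x, t)) ((1:ℝ), (0:ℝ)) Set.univ ξ :=
    ((hasDerivAt_id ξ).prodMk (hasDerivAt_const ξ t)).hasDerivWithinAt
  have := hd.hasFDerivWithinAt.comp_hasDerivWithinAt (x := ξ) (f := fun x : ℝ => (x, t)) h2
    (fun x _ => ⟨trivial, a, b⟩)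
  exact hasDerivWithinAt_univ.1 this

theorem Nice.pd1 (hT : 0 < T) (h : Nice T φ) : Nice T (pd1 φ) := by
  have h1 : ContDiffOn ℝ (⊤ : ℕ∞) (fderivWithin ℝ (fun z : ℝ × ℝ => φ z.1 z.2)
      (Set.univ ×ˢ Set.Ico 0 T)) (Set.univ ×ˢ Set.Ico 0 T) :=
    ContDiffOn.fderivWithin h (uds T hT) (by simp)
  have h2 := h1.clm_apply (contDiffOn_const (c := ((1:ℝ), (0:ℝ))))
  refine h2.congr ?_
  rintro ⟨ξ, t⟩ ⟨_, a, b⟩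
  exact (h.sderiv hT ξ t a b).deriv

theorem Nice.nds (hT : 0 < T) (hρ : Nice T ρ) (h0 : ∀ ξ t : ℝ, 0 ≤ t → t < T → 0 < ρ ξ t)
    (h : Nice T φ) : Nice T (Ds ρ φ) := by
  have := ContDiffOn.div (h.pd1 hT) hρ (fun z hz => (h0 z.1 z.2 hz.2.1 hz.2.2).ne')
  exact this

theorem Nice.sd (hT : 0 < T) (h0 : ∀ ξ t : ℝ, 0 ≤ t → t < T → 0 < ρ ξ t)
    (h : Nice T φ) : Sd T ρ φ (Ds ρ φ) := by
  intro ξ t a b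
  have h1 := h.sderiv hT ξ t a.le b
  have h2 : Ds ρ φ ξ t * ρ ξ t = fderivWithin ℝ (fun z : ℝ × ℝ => φ z.1 z.2)
      (Set.univ ×ˢ Set.Ico 0 T) (ξ, t) (1, 0) := by
    rw [Ds, div_mul_cancel₀ _ (h0 ξ t a.le b).ne']
    exact h1.deriv
  rw [h2]; exact h1

theorem nhd (ξ t : ℝ) (a : 0 < t) (b : t < T) :
    (Set.univ : Set ℝ) ×ˢ Set.Ico (0:ℝ) T ∈ 𝓝 (ξ, t) :=
  prod_mem_nhds univ_mem (Ico_mem_nhds a b)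

theorem Nice.td (h : Nice T φ) : Td T φ (pdt φ) := by
  intro ξ t a b
  have hd : DifferentiableAt ℝ (fun z : ℝ × ℝ => φ z.1 z.2) (ξ, t) :=
    ((h (ξ, t) ⟨trivial, a.le, b⟩).contDiffAt (nhd ξ t a b)).differentiableAt (by simp)
  have h2 : HasDerivAt (fun x : ℝ => (ξ, x)) ((0:ℝ), (1:ℝ)) t :=
    (hasDerivAt_const t ξ).prodMk (hasDerivAt_id t)
  have := hd.hasFDerivAt.comp_hasDerivAt (x := t) (f := fun x : ℝ => (ξ, x)) h2
  exact this.differentiableAt.hasDerivAt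

theorem commut {R φt φts : ℝ → ℝ → ℝ} (hT : 0 < T) (h0 : ∀ ξ t : ℝ, 0 ≤ t → t < T → 0 < ρ ξ t)
    (hρt : Td T ρ (fun ξ t => R ξ t * ρ ξ t))
    (h : Nice T φ) (ht : Td T φ φt) (hts : Sd T ρ φt φts) :
    Td T (Ds ρ φ) (fun ξ t => φts ξ t - R ξ t * Ds ρ φ ξ t) := by
  intro ξ t a b
  set F : ℝ × ℝ → ℝ := fun z => φ z.1 z.2 with hF
  have hcd : ∀ x τ : ℝ, 0 < τ → τ < T → ContDiffAt ℝ (⊤ : ℕ∞) F (x, τ) := fun x τ a b =>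
    (h (x, τ) ⟨trivial, a.le, b⟩).contDiffAt (nhd x τ a b)
  have hdx : ∀ x τ : ℝ, 0 < τ → τ < T → _root_.pd1 φ x τ = fderiv ℝ F (x, τ) (1, 0) := by
    intro x τ a b
    have h2 : HasDerivAt (fun y : ℝ => (y, τ)) ((1:ℝ), (0:ℝ)) x :=
      (hasDerivAt_id x).prodMk (hasDerivAt_const x τ)
    exact (((hcd x τ a b).differentiableAt (by simp)).hasFDerivAt.comp_hasDerivAt x h2).deriv
  have hdt : ∀ x τ : ℝ, 0 < τ → τ < T → φt x τ = fderiv ℝ F (x, τ) (0, 1) := by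
    intro x τ a b
    have h2 : HasDerivAt (fun y : ℝ => (x, y)) ((0:ℝ), (1:ℝ)) τ :=
      (hasDerivAt_const τ x).prodMk (hasDerivAt_id τ)
    exact (ht x τ a b).unique
      (((hcd x τ a b).differentiableAt (by simp)).hasFDerivAt.comp_hasDerivAt τ h2)
  have hsym := ((hcd ξ t a b).isSymmSndFDerivAt (by rw [minSmoothness_of_isRCLikeNormedField]; norm_cast)) (1, 0) (0, 1)
  have hdd : HasFDerivAt (fderiv ℝ F) (fderiv ℝ (fderiv ℝ F) (ξ, t)) (ξ, t) := by
    have : ContDiffAt ℝ 1 (fderiv ℝ F) (ξ, t) :=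
      (hcd ξ t a b).fderiv_right (by norm_cast)
    exact (this.differentiableAt (by simp)).hasFDerivAt
  -- time derivative of pd1
  have e1 : HasDerivAt (fun τ => _root_.pd1 φ ξ τ) (fderiv ℝ (fderiv ℝ F) (ξ, t) (0, 1) (1, 0)) t := by
    have h2 : HasDerivAt (fun y : ℝ => (ξ, y)) ((0:ℝ), (1:ℝ)) t :=
      (hasDerivAt_const t ξ).prodMk (hasDerivAt_id t)
    have h3 := ((ContinuousLinearMap.apply ℝ ℝ ((1:ℝ), (0:ℝ))).hasFDerivAt.comp _ hdd).comp_hasDerivAt t h2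
    have h4 : HasDerivAt (fun τ => fderiv ℝ F (ξ, τ) (1, 0))
        (fderiv ℝ (fderiv ℝ F) (ξ, t) (0, 1) (1, 0)) t := h3
    refine h4.congr_of_eventuallyEq ?_
    filter_upwards [Ioo_mem_nhds a b] with τ hτ using hdx ξ τ hτ.1 hτ.2
  have e2 : HasDerivAt (fun x => φt x t) (fderiv ℝ (fderiv ℝ F) (ξ, t) (1, 0) (0, 1)) ξ := by
    have h2 : HasDerivAt (fun y : ℝ => (y, t)) ((1:ℝ), (0:ℝ)) ξ :=
      (hasDerivAt_id ξ).prodMk (hasDerivAt_const ξ t)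
    have h3 := ((ContinuousLinearMap.apply ℝ ℝ ((0:ℝ), (1:ℝ))).hasFDerivAt.comp _ hdd).comp_hasDerivAt ξ h2
    have h4 : HasDerivAt (fun x => fderiv ℝ F (x, t) (0, 1))
        (fderiv ℝ (fderiv ℝ F) (ξ, t) (1, 0) (0, 1)) ξ := h3
    refine h4.congr_of_eventuallyEq ?_
    filter_upwards with x using hdt x t a b
  have e3 := e2.unique (hts ξ t a b)
  rw [← hsym, e3] at e1
  have hρ := h0 ξ t a.le b
  have := e1.fun_div (hρt ξ t a b) hρ.ne'
  refine this.congr_deriv ?_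
  simp only [Ds]
  field_simp

theorem maxp {Z Zs Zss Zt ρs : ℝ → ℝ → ℝ} {K : ℝ}
    (h0 : ∀ ξ t : ℝ, 0 ≤ t → t < T → 0 < ρ ξ t) (hρs : Sd T ρ ρ ρs)
    (hZ : Nice T Z) (hper : ∀ ξ t, Z (ξ + 2 * π) t = Z ξ t)
    (hs : Sd T ρ Z Zs) (hss : Sd T ρ Zs Zss) (ht : Td T Z Zt)
    (hinit : ∀ ξ, Z ξ 0 ≤ K)
    (hstep : ∀ ξ t, 0 < t → t < T → K < Z ξ t → Zs ξ t = 0 → Zss ξ t ≤ 0 → Zt ξ t < 0) :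
    ∀ ξ t, 0 ≤ t → t < T → Z ξ t ≤ K := by
  intro ξ₀ t₀ a₀ b₀
  by_contra hK
  push Not at hK
  have hc : IsCompact (Set.Icc (0:ℝ) (2 * π) ×ˢ Set.Icc 0 t₀) := isCompact_Icc.prod isCompact_Icc
  have hpp : ∀ t, Function.Periodic (fun x => Z x t) (2 * π) := fun t x => hper x t
  have hred : ∀ x t, ∃ y ∈ Set.Icc (0:ℝ) (2 * π), Z x t = Z y t := by
    intro x t
    obtain ⟨y, hy, e⟩ := (hpp t).exists_mem_Ico₀ Real.two_pi_pos x
    exact ⟨y, ⟨hy.1, hy.2.le⟩, e⟩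
  have hcont : ContinuousOn (fun z : ℝ × ℝ => Z z.1 z.2) (Set.Icc (0:ℝ) (2 * π) ×ˢ Set.Icc 0 t₀) :=
    hZ.continuousOn.mono (fun z hz => ⟨trivial, hz.2.1, hz.2.2.trans_lt b₀⟩)
  obtain ⟨⟨ξ, t⟩, ⟨hξ, htm⟩, hmax⟩ := hc.exists_isMaxOn
    ⟨(0, 0), ⟨⟨le_rfl, Real.two_pi_pos.le⟩, ⟨le_rfl, a₀⟩⟩⟩ hcont
  have hmax' : ∀ x τ, 0 ≤ τ → τ ≤ t₀ → Z x τ ≤ Z ξ t := by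
    intro x τ a b
    obtain ⟨y, hy, e⟩ := hred x τ
    rw [e]
    exact hmax (a := (y, τ)) ⟨hy, a, b⟩
  have hZK : K < Z ξ t := hK.trans_le (hmax' _ _ a₀ le_rfl)
  have htpos : 0 < t := by
    rcases htm.1.eq_or_lt with e | e
    · exact absurd (hinit ξ) (by simp only at e; rw [← e] at hZK; exact not_le.2 hZK)
    · exact e
  have htT : t < T := htm.2.trans_lt b₀
  have hρ := h0 ξ t htpos.le htT
  have hlm : IsLocalMax (fun x => Z x t) ξ :=
    Filter.Eventually.of_forall (fun x => hmax' x t htpos.le htm.2)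
  have hz1 : Zs ξ t = 0 := by
    have := hlm.hasDerivAt_eq_zero (hs ξ t htpos htT)
    rcases mul_eq_zero.1 this with h | h
    · exact h
    · exact absurd h hρ.ne'
  have hder : deriv (fun x => Z x t) = fun x => Zs x t * ρ x t := by
    funext x; exact (hs x t htpos htT).deriv
  have hd2 : deriv (deriv (fun x => Z x t)) ξ = Zss ξ t * ρ ξ t * ρ ξ t := by
    rw [hder]
    rw [((hss ξ t htpos htT).fun_mul (hρs ξ t htpos htT)).deriv, hz1]; ring
  have hz2 : Zss ξ t ≤ 0 := by
    by_contra hh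
    push Not at hh
    have hpos : 0 < deriv (deriv (fun x => Z x t)) ξ := by rw [hd2]; positivity
    have hmin := isLocalMin_of_deriv_deriv_pos hpos (by rw [hder]; simp [hz1])
      (hs ξ t htpos htT).continuousAt
    have hcst : (fun x => Z x t) =ᶠ[𝓝 ξ] fun _ => Z ξ t := by
      filter_upwards [hmin, hlm] with x h1 h2 using le_antisymm h2 h1
    have := hcst.deriv.deriv_eq
    rw [this] at hpos
    simp at hpos
  have hlt := hstep ξ t htpos htT hZK hz1 hz2
  -- time derivative is nonnegative
  have hge : 0 ≤ Zt ξ t := by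
    have hd := (ht ξ t htpos htT).hasDerivWithinAt (s := Set.Iio t)
    rw [hasDerivWithinAt_iff_tendsto_slope' (by simp)] at hd
    refine ge_of_tendsto hd ?_
    filter_upwards [Ioo_mem_nhdsLT htpos] with τ hτ
    rw [slope_def_field]
    apply div_nonneg_of_nonpos
    · have := hmax' ξ τ hτ.1.le (hτ.2.le.trans htm.2)
      linarith
    · linarith [hτ.2]
  linarith

theorem Nice.initBd (hT : 0 < T) {Z : ℝ → ℝ → ℝ}
    (hZ : Nice T Z) (hper : ∀ ξ t, Z (ξ + 2 * π) t = Z ξ t) :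
    ∃ K, ∀ ξ, Z ξ 0 ≤ K := by
  have hcont : ContinuousOn (fun x => Z x 0) (Set.Icc (0:ℝ) (2 * π)) := by
    have := hZ.continuousOn.comp (s := Set.Icc (0:ℝ) (2 * π)) (f := fun x : ℝ => (x, (0:ℝ)))
      (by fun_prop) (fun x _ => ⟨trivial, le_rfl, hT⟩)
    exact this
  obtain ⟨K, hK⟩ := isCompact_Icc.bddAbove_image hcont
  refine ⟨K, fun ξ => ?_⟩
  have hpp : Function.Periodic (fun x => Z x 0) (2 * π) := fun x => hper x 0
  obtain ⟨y, hy, e⟩ := hpp.exists_mem_Ico₀ Real.two_pi_pos ξ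
  change Z ξ 0 = Z y 0 at e
  rw [e]
  exact hK ⟨y, ⟨hy.1, hy.2.le⟩, rfl⟩

theorem perDs (hφ : ∀ ξ t, φ (ξ + 2 * π) t = φ ξ t) (hρ : ∀ ξ t, ρ (ξ + 2 * π) t = ρ ξ t) :
    ∀ ξ t, Ds ρ φ (ξ + 2 * π) t = Ds ρ φ ξ t := by
  intro ξ t
  unfold Ds pd1
  rw [hρ]
  congr 1
  rw [← deriv_comp_add_const]
  congr 1
  funext x
  exact hφ x t

/-- combined max principle with initial bound -/
theorem maxp2 {Z Zs Zss Zt ρs : ℝ → ℝ → ℝ} (K : ℝ) (hT : 0 < T)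
    (h0 : ∀ ξ t : ℝ, 0 ≤ t → t < T → 0 < ρ ξ t) (hρs : Sd T ρ ρ ρs)
    (hZ : Nice T Z) (hper : ∀ ξ t, Z (ξ + 2 * π) t = Z ξ t)
    (hs : Sd T ρ Z Zs) (hss : Sd T ρ Zs Zss) (ht : Td T Z Zt)
    (hstep : ∀ ξ t, 0 < t → t < T → K < Z ξ t → Zs ξ t = 0 → Zss ξ t ≤ 0 → Zt ξ t < 0) :
    ∃ B, ∀ ξ t, 0 ≤ t → t < T → Z ξ t ≤ B := by
  obtain ⟨K', hK'⟩ := hZ.initBd hT hper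
  exact ⟨max K K', maxp h0 hρs hZ hper hs hss ht (fun ξ => (hK' ξ).trans (le_max_right _ _))
    (fun ξ t a b h => hstep ξ t a b ((le_max_left _ _).trans_lt h))⟩

end calculus

theorem boxBd (B : ℝ) (h : ℝ → ℝ → ℝ → ℝ → ℝ)
    (hc : Continuous (fun z : ℝ × ℝ × ℝ × ℝ => h z.1 z.2.1 z.2.2.1 z.2.2.2)) :
    ∃ N, 0 ≤ N ∧ ∀ p q u v, |p| ≤ B → |q| ≤ B → |u| ≤ B → |v| ≤ B → |h p q u v| ≤ N := by
  have hK : IsCompact (Set.Icc (-B) B ×ˢ Set.Icc (-B) B ×ˢ Set.Icc (-B) B ×ˢ Set.Icc (-B) B) :=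
    isCompact_Icc.prod (isCompact_Icc.prod (isCompact_Icc.prod isCompact_Icc))
  obtain ⟨N, hN⟩ := hK.exists_bound_of_continuousOn hc.continuousOn
  refine ⟨max N 0, le_max_right _ _, fun p q u v a b c d => ?_⟩
  exact (hN (p, q, u, v) ⟨abs_le.1 a, abs_le.1 b, abs_le.1 c, abs_le.1 d⟩).trans (le_max_left _ _)

theorem absBd {p C : ℝ} (h : p ^ 2 ≤ C) : |p| ≤ 1 + |C| := by
  have := le_abs_self C
  rw [abs_le]
  constructor <;> nlinarith [sq_nonneg (p - 1), sq_nonneg (p + 1)]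

theorem quadNeg {N c0 c1 c2 X Y : ℝ} (σ : ℝ) (hσ : σ = 1 ∨ σ = -1)
    (hN : 0 ≤ N) (h0 : |c0| ≤ N) (h1 : |c1| ≤ N) (h2 : |c2| ≤ N)
    (hX : N + 2 ≤ |X|) :
    -2 * σ * X ^ 2 - 4 * X ^ 2 - 4 * Y ^ 2 + c1 * X + c2 * Y + c0 < 0 := by
  have a1 : c1 * X ≤ N * |X| := (le_abs_self _).trans (by rw [abs_mul]; gcongr)
  have a2 : c2 * Y ≤ N * |Y| := (le_abs_self _).trans (by rw [abs_mul]; gcongr)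
  have a0 := (le_abs_self c0).trans h0
  have hA : -2 * σ * X ^ 2 - 4 * X ^ 2 ≤ -2 * X ^ 2 := by
    rcases hσ with rfl | rfl <;> nlinarith [sq_nonneg X]
  have : -2 * X ^ 2 - 4 * Y ^ 2 + c1 * X + c2 * Y + c0 < 0 := by
    rw [← sq_abs X, ← sq_abs Y]
    nlinarith [sq_nonneg (8 * |Y| - N), mul_nonneg hN (sub_nonneg.2 hX), abs_nonneg X,
      sq_nonneg (|X| - (N + 2))]
  linarith

def cP (p q u v : ℝ) : ℝ := 4 * p * (-2 * q ^ 2 * p - 6 * u ^ 2 * p + 8 * u ^ 3 * q)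
    + 4 * q * (-(p ^ 2 * v ^ 2 + q ^ 2) * q + 4 * u * p + (4 - 6 * u ^ 2) * q)

def cF1 (σ p q u v : ℝ) : ℝ := σ * (2 * p * q - 2 * u ^ 3)
    + σ * (2 * q - 3 * p * v) * (-p - 4 * σ * p)
    + σ * (-4 * u * q ^ 2 + v * p ^ 2 - 6 * u ^ 3) + 4 * p * (2 * q - p * v)

def cF2 (σ p q u v : ℝ) : ℝ := σ * (2 * q - 3 * p * v) * (-4 * σ * q)
    + σ * (-4 * u * p * q + 8 * u ^ 4) + 4 * q * p * v

def cF0 (σ p q u v : ℝ) : ℝ := σ * (4 * u * q ^ 3 * p - 12 * u ^ 2 * p ^ 2 + 48 * u ^ 3 * p * q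
    - 40 * u ^ 4 * q ^ 2) + cP p q u v

def cG1 (σ p q u v : ℝ) : ℝ := σ * (v * p - 2 * q) * (-4 * σ * p)
    + σ * (-2 * p * q * v ^ 2 + 4 * u) + 4 * p * (2 * q - p * v)

def cG2 (σ p q u v : ℝ) : ℝ := σ * (p * q * v + q ^ 2 + 2 * u ^ 2 - 4)
    + σ * (v * p - 2 * q) * (-q - 4 * σ * q)
    + σ * (-2 * p ^ 2 * v ^ 2 - 3 * q ^ 2 + 4 - 6 * u ^ 2) + 4 * q * p * v

def cG0 (σ p q u v : ℝ) : ℝ := σ * (2 * p ^ 3 * q * v ^ 3 + 2 * q ^ 4 + 4 * p ^ 2 - 24 * u * p * q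
    - 8 * q ^ 2 + 24 * u ^ 2 * q ^ 2) + cP p q u v

theorem algF {σ f g p q x y x1 x2 y1 : ℝ} (hσ : σ = 1 ∨ σ = -1) (hf : 0 < f) (hg : 0 < g)
    (hs : σ * (p * x + f * x1) + 4 * (p * x + q * y) = 0) :
    σ * ((x + 2 * (q / g) * p - 2 * f ^ 3 / g ^ 4) * x + f * (x2 + (2 * (q / g) - p / f) * x1
      - 2 * x ^ 2 / f - 4 * q ^ 2 * x / g ^ 2 + p ^ 2 * x / f ^ 2
      - 4 * q * y * p / g ^ 2 + 4 * q ^ 3 * p / g ^ 3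
      - 12 * f * p ^ 2 / g ^ 4 - 6 * f ^ 2 * x / g ^ 4
      + 48 * f ^ 2 * p * q / g ^ 5 + 8 * f ^ 3 * y / g ^ 5
      - 40 * f ^ 3 * q ^ 2 / g ^ 6)) + 4 * (p * (x1 + 2 * (q / g) * x - p * x / f
      - 2 * (q ^ 2 * p / g ^ 2) - 6 * (f ^ 2 * p / g ^ 4)
      + 8 * (f ^ 3 * q / g ^ 5)) + q * (y1 + p * y / f - p ^ 2 * q / f ^ 2
      - q ^ 3 / g ^ 2 + 4 * (f * p / g ^ 3) + 4 * (q / g ^ 2)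
      - 6 * (f ^ 2 * q / g ^ 4)))
    = (σ * (x * x + 2 * p * x1 + f * x2) + 4 * (x ^ 2 + p * x1 + y ^ 2 + q * y1))
      + (-2 * σ * (g * x) ^ 2 - 4 * (g * x) ^ 2 - 4 * (g * y) ^ 2
        + cF1 σ p q (f / g) (g / f) * (g * x) + cF2 σ p q (f / g) (g / f) * (g * y)
        + cF0 σ p q (f / g) (g / f)) / g ^ 2 := by
  have hx1 : x1 = (-p * x - 4 * σ * (p * x + q * y)) / f := by
    rw [eq_div_iff hf.ne']
    rcases hσ with rfl | rfl <;> linarith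
  subst hx1
  simp only [cF1, cF2, cF0, cP]
  rcases hσ with rfl | rfl
  · field_simp
    ring
  · field_simp
    ring

theorem algG {σ f g p q x y x1 y2 y1 : ℝ} (hσ : σ = 1 ∨ σ = -1) (hf : 0 < f) (hg : 0 < g)
    (hs : σ * (q * y + g * y1) + 4 * (p * x + q * y) = 0) :
    σ * ((y + (p / f + q / g) * q + 2 * (f ^ 2 - 2 * g ^ 2) / g ^ 3) * y
      + g * (y2 + p / f * y1 - 2 * y ^ 2 / g
      - 2 * p ^ 2 * y / f ^ 2 - 2 * p * x * q / f ^ 2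
      + 2 * p ^ 3 * q / f ^ 3 - 3 * q ^ 2 * y / g ^ 2
      + 2 * q ^ 4 / g ^ 3 + 4 * p ^ 2 / g ^ 3 + 4 * f * x / g ^ 3
      - 24 * f * p * q / g ^ 4 + (4 / g ^ 2 - 6 * f ^ 2 / g ^ 4) * y
      - 8 * q ^ 2 / g ^ 3 + 24 * f ^ 2 * q ^ 2 / g ^ 5))
      + 4 * (p * (x1 + 2 * (q / g) * x - p * x / f
      - 2 * (q ^ 2 * p / g ^ 2) - 6 * (f ^ 2 * p / g ^ 4)
      + 8 * (f ^ 3 * q / g ^ 5)) + q * (y1 + p * y / f - p ^ 2 * q / f ^ 2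
      - q ^ 3 / g ^ 2 + 4 * (f * p / g ^ 3) + 4 * (q / g ^ 2)
      - 6 * (f ^ 2 * q / g ^ 4)))
    = (σ * (y * y + 2 * q * y1 + g * y2) + 4 * (x ^ 2 + p * x1 + y ^ 2 + q * y1))
      + (-2 * σ * (g * y) ^ 2 - 4 * (g * y) ^ 2 - 4 * (g * x) ^ 2
        + cG2 σ p q (f / g) (g / f) * (g * y) + cG1 σ p q (f / g) (g / f) * (g * x)
        + cG0 σ p q (f / g) (g / f)) / g ^ 2 := by
  have hy1 : y1 = (-q * y - 4 * σ * (p * x + q * y)) / g := by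
    rw [eq_div_iff hg.ne']
    rcases hσ with rfl | rfl <;> linarith
  subst hy1
  simp only [cG1, cG2, cG0, cP]
  rcases hσ with rfl | rfl
  · field_simp
    ring
  · field_simp
    ring

structure Jet (T : ℝ) (ρ f g p q x y x1 y1 x2 y2 ρs : ℝ → ℝ → ℝ) : Prop where
  T_pos : 0 < T
  f_pos : ∀ ξ t : ℝ, 0 ≤ t → t < T → 0 < f ξ t
  g_pos : ∀ ξ t : ℝ, 0 ≤ t → t < T → 0 < g ξ t
  r_pos : ∀ ξ t : ℝ, 0 ≤ t → t < T → 0 < ρ ξ t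
  nf : Nice T f
  ng : Nice T g
  np : Nice T p
  nq : Nice T q
  nx : Nice T x
  ny : Nice T y
  pf : ∀ ξ t, f (ξ + 2 * π) t = f ξ t
  pg : ∀ ξ t, g (ξ + 2 * π) t = g ξ t
  pp : ∀ ξ t, p (ξ + 2 * π) t = p ξ t
  pq : ∀ ξ t, q (ξ + 2 * π) t = q ξ t
  px : ∀ ξ t, x (ξ + 2 * π) t = x ξ t
  py : ∀ ξ t, y (ξ + 2 * π) t = y ξ t
  sr : Sd T ρ ρ ρs
  sf : Sd T ρ f p
  sg : Sd T ρ g q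
  sp : Sd T ρ p x
  sq : Sd T ρ q y
  sx : Sd T ρ x x1
  sy : Sd T ρ y y1
  sx1 : Sd T ρ x1 x2
  sy1 : Sd T ρ y1 y2
  tf : Td T f (fun ξ t => x ξ t + 2 * (q ξ t / g ξ t) * p ξ t - 2 * f ξ t ^ 3 / g ξ t ^ 4)
  tg : Td T g (fun ξ t => y ξ t + (p ξ t / f ξ t + q ξ t / g ξ t) * q ξ t
      + 2 * (f ξ t ^ 2 - 2 * g ξ t ^ 2) / g ξ t ^ 3)
  tp : Td T p (fun ξ t => x1 ξ t + 2 * (q ξ t / g ξ t) * x ξ t - p ξ t * x ξ t / f ξ t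
      - 2 * (q ξ t ^ 2 * p ξ t / g ξ t ^ 2) - 6 * (f ξ t ^ 2 * p ξ t / g ξ t ^ 4)
      + 8 * (f ξ t ^ 3 * q ξ t / g ξ t ^ 5))
  tq : Td T q (fun ξ t => y1 ξ t + p ξ t * y ξ t / f ξ t - p ξ t ^ 2 * q ξ t / f ξ t ^ 2
      - q ξ t ^ 3 / g ξ t ^ 2 + 4 * (f ξ t * p ξ t / g ξ t ^ 3) + 4 * (q ξ t / g ξ t ^ 2)
      - 6 * (f ξ t ^ 2 * q ξ t / g ξ t ^ 4))
  tx : Td T x (fun ξ t => x2 ξ t + (2 * (q ξ t / g ξ t) - p ξ t / f ξ t) * x1 ξ t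
      - 2 * x ξ t ^ 2 / f ξ t - 4 * q ξ t ^ 2 * x ξ t / g ξ t ^ 2 + p ξ t ^ 2 * x ξ t / f ξ t ^ 2
      - 4 * q ξ t * y ξ t * p ξ t / g ξ t ^ 2 + 4 * q ξ t ^ 3 * p ξ t / g ξ t ^ 3
      - 12 * f ξ t * p ξ t ^ 2 / g ξ t ^ 4 - 6 * f ξ t ^ 2 * x ξ t / g ξ t ^ 4
      + 48 * f ξ t ^ 2 * p ξ t * q ξ t / g ξ t ^ 5 + 8 * f ξ t ^ 3 * y ξ t / g ξ t ^ 5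
      - 40 * f ξ t ^ 3 * q ξ t ^ 2 / g ξ t ^ 6)
  ty : Td T y (fun ξ t => y2 ξ t + p ξ t / f ξ t * y1 ξ t - 2 * y ξ t ^ 2 / g ξ t
      - 2 * p ξ t ^ 2 * y ξ t / f ξ t ^ 2 - 2 * p ξ t * x ξ t * q ξ t / f ξ t ^ 2
      + 2 * p ξ t ^ 3 * q ξ t / f ξ t ^ 3 - 3 * q ξ t ^ 2 * y ξ t / g ξ t ^ 2
      + 2 * q ξ t ^ 4 / g ξ t ^ 3 + 4 * p ξ t ^ 2 / g ξ t ^ 3 + 4 * f ξ t * x ξ t / g ξ t ^ 3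
      - 24 * f ξ t * p ξ t * q ξ t / g ξ t ^ 4 + (4 / g ξ t ^ 2 - 6 * f ξ t ^ 2 / g ξ t ^ 4) * y ξ t
      - 8 * q ξ t ^ 2 / g ξ t ^ 3 + 24 * f ξ t ^ 2 * q ξ t ^ 2 / g ξ t ^ 5)

theorem mkJet (T : ℝ) (f g ρ : ℝ → ℝ → ℝ) (W : WarpedBerger T f g ρ) :
    Jet T ρ f g (Ds ρ f) (Ds ρ g) (Ds ρ (Ds ρ f)) (Ds ρ (Ds ρ g)) (Ds ρ (Ds ρ (Ds ρ f)))
      (Ds ρ (Ds ρ (Ds ρ g))) (Ds ρ (Ds ρ (Ds ρ (Ds ρ f)))) (Ds ρ (Ds ρ (Ds ρ (Ds ρ g))))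
      (Ds ρ ρ) := by
  have hT := W.T_pos
  have hr := W.ρ_pos
  have nf : Nice T f := contDiff_fst.comp_contDiffOn W.smooth
  have ng : Nice T g := (contDiff_fst.comp contDiff_snd).comp_contDiffOn W.smooth
  have nr : Nice T ρ := (contDiff_snd.comp contDiff_snd).comp_contDiffOn W.smooth
  have np := Nice.nds hT nr hr nf
  have nx := Nice.nds hT nr hr np
  have nx1 := Nice.nds hT nr hr nx
  have nq := Nice.nds hT nr hr ng
  have ny := Nice.nds hT nr hr nq
  have ny1 := Nice.nds hT nr hr ny
  have sf := nf.sd hT hr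
  have sg := ng.sd hT hr
  have sp := np.sd hT hr
  have sq := nq.sd hT hr
  have sx := nx.sd hT hr
  have sy := ny.sd hT hr
  have f0 : ∀ ξ t : ℝ, 0 < t → t < T → f ξ t ≠ 0 := fun ξ t a b => (W.f_pos ξ t a.le b).ne'
  have g0 : ∀ ξ t : ℝ, 0 < t → t < T → g ξ t ≠ 0 := fun ξ t a b => (W.g_pos ξ t a.le b).ne'
  have gn : ∀ n : ℕ, ∀ ξ t : ℝ, 0 < t → t < T → g ξ t ^ n ≠ 0 :=
    fun n ξ t a b => pow_ne_zero n (g0 ξ t a b)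
  have fn : ∀ n : ℕ, ∀ ξ t : ℝ, 0 < t → t < T → f ξ t ^ n ≠ 0 :=
    fun n ξ t a b => pow_ne_zero n (f0 ξ t a b)
  have tr : Td T ρ (fun ξ t => (Ds ρ (Ds ρ f) ξ t / f ξ t + 2 * (Ds ρ (Ds ρ g) ξ t / g ξ t)) * ρ ξ t) := by
    intro ξ t a b
    have h1 := nr.td ξ t a b
    have h2 := (h1.log (hr ξ t a.le b).ne').deriv
    have h3 := W.eq_ρ ξ t a b
    unfold pdt at h3
    rw [h3] at h2
    simp only
    rw [h2, div_mul_cancel₀ _ (hr ξ t a.le b).ne']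
    exact h1
  have tf := nf.td.congr W.eq_f
  have tg := ng.td.congr W.eq_g
  have tp : Td T (Ds ρ f) (fun ξ t => Ds ρ (Ds ρ (Ds ρ f)) ξ t
      + 2 * (Ds ρ g ξ t / g ξ t) * Ds ρ (Ds ρ f) ξ t - Ds ρ f ξ t * Ds ρ (Ds ρ f) ξ t / f ξ t
      - 2 * (Ds ρ g ξ t ^ 2 * Ds ρ f ξ t / g ξ t ^ 2) - 6 * (f ξ t ^ 2 * Ds ρ f ξ t / g ξ t ^ 4)
      + 8 * (f ξ t ^ 3 * Ds ρ g ξ t / g ξ t ^ 5)) := by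
    refine (commut hT hr tr nf tf ((sx.add (((sq.div sg g0).cmul 2).mul sp)).sub
      (((sf.pow 3).cmul 2).div (sg.pow 4) (gn 4)))).congr ?_
    intro ξ t a b
    have h1 := f0 ξ t a b
    have h2 := g0 ξ t a b
    norm_num
    field_simp
    ring
  have tq : Td T (Ds ρ g) (fun ξ t => Ds ρ (Ds ρ (Ds ρ g)) ξ t
      + Ds ρ f ξ t * Ds ρ (Ds ρ g) ξ t / f ξ t - Ds ρ f ξ t ^ 2 * Ds ρ g ξ t / f ξ t ^ 2
      - Ds ρ g ξ t ^ 3 / g ξ t ^ 2 + 4 * (f ξ t * Ds ρ f ξ t / g ξ t ^ 3) + 4 * (Ds ρ g ξ t / g ξ t ^ 2)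
      - 6 * (f ξ t ^ 2 * Ds ρ g ξ t / g ξ t ^ 4)) := by
    refine (commut hT hr tr ng tg ((sy.add (((sp.div sf f0).add (sq.div sg g0)).mul sq)).add
      ((((sf.pow 2).sub ((sg.pow 2).cmul 2)).cmul 2).div (sg.pow 3) (gn 3)))).congr ?_
    intro ξ t a b
    have h1 := f0 ξ t a b
    have h2 := g0 ξ t a b
    norm_num
    field_simp
    ring
  have sx1 := nx1.sd hT hr
  have sy1 := ny1.sd hT hr
  refine ⟨hT, W.f_pos, W.g_pos, hr, nf, ng, np, nq, nx, ny, W.f_per, W.g_per,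
    perDs W.f_per W.ρ_per, perDs W.g_per W.ρ_per, perDs (perDs W.f_per W.ρ_per) W.ρ_per,
    perDs (perDs W.g_per W.ρ_per) W.ρ_per, nr.sd hT hr, sf, sg, sp, sq, sx, sy, sx1, sy1,
    tf, tg, tp, tq, ?_, ?_⟩
  · refine (commut hT hr tr np tp (((((sx1.add (((sq.div sg g0).cmul 2).mul sx)).sub
      ((sp.mul sx).div sf f0)).sub ((((sq.pow 2).mul sp).div (sg.pow 2) (gn 2)).cmul 2)).sub
      ((((sf.pow 2).mul sp).div (sg.pow 4) (gn 4)).cmul 6)).add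
      ((((sf.pow 3).mul sq).div (sg.pow 5) (gn 5)).cmul 8))).congr ?_
    intro ξ t a b
    have h1 := f0 ξ t a b
    have h2 := g0 ξ t a b
    norm_num
    field_simp
    ring
  · refine (commut hT hr tr nq tq ((((((sy1.add ((sp.mul sy).div sf f0)).sub
      (((sp.pow 2).mul sq).div (sf.pow 2) (fn 2))).sub ((sq.pow 3).div (sg.pow 2) (gn 2))).add
      (((sf.mul sp).div (sg.pow 3) (gn 3)).cmul 4)).add
      ((sq.div (sg.pow 2) (gn 2)).cmul 4)).sub
      ((((sf.pow 2).mul sq).div (sg.pow 4) (gn 4)).cmul 6))).congr ?_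
    intro ξ t a b
    have h1 := f0 ξ t a b
    have h2 := g0 ξ t a b
    norm_num
    field_simp
    ring

namespace Jet
variable {T : ℝ} {ρ f g p q x y x1 y1 x2 y2 ρs : ℝ → ℝ → ℝ}

theorem nlog {φ : ℝ → ℝ → ℝ} (h : Nice T φ) (h0 : ∀ ξ t : ℝ, 0 ≤ t → t < T → 0 < φ ξ t) :
    Nice T (fun ξ t => Real.log (φ ξ t)) :=
  ContDiffOn.log h (fun z hz => (h0 z.1 z.2 hz.2.1 hz.2.2).ne')

theorem f_le (J : Jet T ρ f g p q x y x1 y1 x2 y2 ρs) (hi : ∀ ξ, f ξ 0 ≤ g ξ 0) :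
    ∀ ξ t, 0 ≤ t → t < T → f ξ t ≤ g ξ t := by
  have f0 : ∀ ξ t : ℝ, 0 < t → t < T → f ξ t ≠ 0 := fun ξ t a b => (J.f_pos ξ t a.le b).ne'
  have g0 : ∀ ξ t : ℝ, 0 < t → t < T → g ξ t ≠ 0 := fun ξ t a b => (J.g_pos ξ t a.le b).ne'
  have key := maxp (K := 0) J.r_pos J.sr (Z := fun ξ t => Real.log (f ξ t) - Real.log (g ξ t))
    ((nlog J.nf J.f_pos).sub (nlog J.ng J.g_pos)) (fun ξ t => by simp only [J.pf, J.pg])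
    ((J.sf.log f0).sub (J.sg.log g0))
    ((J.sp.div J.sf f0).sub (J.sq.div J.sg g0)) ((J.tf.log f0).sub (J.tg.log g0))
    (fun ξ => sub_nonpos.2 (Real.log_le_log (J.f_pos ξ 0 le_rfl J.T_pos) (hi ξ))) ?_
  · intro ξ t a b
    exact (Real.log_le_log_iff (J.f_pos ξ t a b) (J.g_pos ξ t a b)).1 (sub_nonpos.1 (key ξ t a b))
  · intro ξ t a b hK hs hss
    have hf := J.f_pos ξ t a.le b
    have hg := J.g_pos ξ t a.le b
    have hlt : g ξ t < f ξ t := (Real.log_lt_log_iff hg hf).1 (sub_pos.1 hK)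
    beta_reduce at hs hss ⊢
    generalize f ξ t = f at *
    generalize g ξ t = g at *
    generalize p ξ t = p at *
    generalize q ξ t = q at *
    generalize x ξ t = x at *
    generalize y ξ t = y at *
    have hp : p = f * q / g := by field_simp at hs ⊢; linarith
    subst hp
    have e : (x + 2 * (q / g) * (f * q / g) - 2 * f ^ 3 / g ^ 4) / f
      - (y + (f * q / g / f + q / g) * q + 2 * (f ^ 2 - 2 * g ^ 2) / g ^ 3) / g
      = ((x * f - f * q / g * (f * q / g)) / f ^ 2 - (y * g - q * q) / g ^ 2)
        - 4 * ((f ^ 2 - g ^ 2) / g ^ 4) := by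
      field_simp
      ring
    rw [e]
    have : 0 < (f ^ 2 - g ^ 2) / g ^ 4 := by
      apply div_pos _ (by positivity)
      nlinarith
    linarith

theorem g_le (J : Jet T ρ f g p q x y x1 y1 x2 y2 ρs) (hi : ∀ ξ, f ξ 0 ≤ g ξ 0) :
    ∃ V, ∀ ξ t, 0 ≤ t → t < T → g ξ t / f ξ t ≤ V := by
  have f0 : ∀ ξ t : ℝ, 0 < t → t < T → f ξ t ≠ 0 := fun ξ t a b => (J.f_pos ξ t a.le b).ne'
  have g0 : ∀ ξ t : ℝ, 0 < t → t < T → g ξ t ≠ 0 := fun ξ t a b => (J.g_pos ξ t a.le b).ne'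
  have key := maxp2 0 J.T_pos J.r_pos J.sr (Z := fun ξ t => Real.log (g ξ t) - Real.log (f ξ t))
    ((nlog J.ng J.g_pos).sub (nlog J.nf J.f_pos)) (fun ξ t => by simp only [J.pf, J.pg])
    ((J.sg.log g0).sub (J.sf.log f0))
    ((J.sq.div J.sg g0).sub (J.sp.div J.sf f0)) ((J.tg.log g0).sub (J.tf.log f0)) ?_
  · obtain ⟨B, hB⟩ := key
    refine ⟨Real.exp B, fun ξ t a b => ?_⟩
    have hf := J.f_pos ξ t a b
    have hg := J.g_pos ξ t a b
    have := hB ξ t a b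
    beta_reduce at this
    rw [← Real.log_div hg.ne' hf.ne'] at this
    exact (Real.log_le_iff_le_exp (div_pos hg hf)).1 this
  · intro ξ t a b hK hs hss
    have hf := J.f_pos ξ t a.le b
    have hg := J.g_pos ξ t a.le b
    have hlt : f ξ t < g ξ t := (Real.log_lt_log_iff hf hg).1 (sub_pos.1 hK)
    beta_reduce at hs hss ⊢
    generalize f ξ t = f at *
    generalize g ξ t = g at *
    generalize p ξ t = p at *
    generalize q ξ t = q at *
    generalize x ξ t = x at *
    generalize y ξ t = y at *
    have hp : p = f * q / g := by field_simp at hs ⊢; linarith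
    subst hp
    have e : (y + (f * q / g / f + q / g) * q + 2 * (f ^ 2 - 2 * g ^ 2) / g ^ 3) / g
      - (x + 2 * (q / g) * (f * q / g) - 2 * f ^ 3 / g ^ 4) / f
      = ((y * g - q * q) / g ^ 2 - (x * f - f * q / g * (f * q / g)) / f ^ 2)
        - 4 * ((g ^ 2 - f ^ 2) / g ^ 4) := by
      field_simp
      ring
    rw [e]
    have : 0 < (g ^ 2 - f ^ 2) / g ^ 4 := by
      apply div_pos _ (by positivity)
      nlinarith
    linarith

theorem p_bd (J : Jet T ρ f g p q x y x1 y1 x2 y2 ρs) (hi : ∀ ξ, f ξ 0 ≤ g ξ 0) :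
    ∃ B, ∀ ξ t, 0 ≤ t → t < T → p ξ t ^ 2 ≤ B := by
  refine maxp2 2 J.T_pos J.r_pos J.sr (Z := fun ξ t => p ξ t ^ 2)
    (J.np.pow 2) (fun ξ t => by simp only [J.pp]) (J.sp.pow 2)
    (((J.sp.cmul 2).mul J.sx).congr (φ := fun ξ t => 2 * p ξ t * x ξ t) (fun _ _ _ _ => rfl) |>
      fun h => by simpa using h) (J.tp.pow 2) ?_
  intro ξ t a b hK hs hss
  have hf := J.f_pos ξ t a.le b
  have hg := J.g_pos ξ t a.le b
  have hle := J.f_le hi ξ t a.le b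
  beta_reduce at hs hss hK ⊢
  norm_num at hs hss ⊢
  generalize f ξ t = f at *
  generalize g ξ t = g at *
  generalize p ξ t = p at *
  generalize q ξ t = q at *
  generalize x ξ t = x at *
  generalize x1 ξ t = x1 at *
  have hp0 : p ≠ 0 := by rintro rfl; norm_num at hK
  have hx : x = 0 := by
    rcases hs with h | h
    · exact absurd h hp0
    · exact h
  subst hx
  have e : 2 * p * (x1 + 2 * (q / g) * 0 - p * 0 / f - 2 * (q ^ 2 * p / g ^ 2)
      - 6 * (f ^ 2 * p / g ^ 4) + 8 * (f ^ 3 * q / g ^ 5))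
      = 2 * p * x1 - 2 * ((2 * (p * q * g) ^ 2 + 6 * f ^ 2 * p ^ 2
          - 8 * f * (f / g) ^ 2 * (p * q * g)) / g ^ 4) := by
    field_simp
    ring
  have hu : f / g ≤ 1 := (div_le_one hg).2 hle
  have hu0 : 0 < f / g := div_pos hf hg
  rw [show ∀ z, 2 * p * z = 2 * p * z from fun _ => rfl]
  have e2 : 0 < (2 * (p * q * g) ^ 2 + 6 * f ^ 2 * p ^ 2
          - 8 * f * (f / g) ^ 2 * (p * q * g)) / g ^ 4 := by
    apply div_pos _ (by positivity)
    generalize f / g = u at *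
    generalize p * q * g = w at *
    have h4 : u ^ 4 ≤ 1 := pow_le_one₀ hu0.le hu
    have h5 : f ^ 2 * u ^ 4 ≤ f ^ 2 := by nlinarith [sq_nonneg f]
    have h6 : 0 < f ^ 2 := by positivity
    nlinarith [sq_nonneg (w - 2 * f * u ^ 2)]
  have hss' : 2 * p * x1 ≤ 0 := by nlinarith
  nlinarith [e]

theorem q_bd (J : Jet T ρ f g p q x y x1 y1 x2 y2 ρs) (hi : ∀ ξ, f ξ 0 ≤ g ξ 0) :
    ∃ B, ∀ ξ t, 0 ≤ t → t < T → q ξ t ^ 2 ≤ B := by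
  obtain ⟨B, hB⟩ := J.p_bd hi
  refine maxp2 (7 + 2 * B) J.T_pos J.r_pos J.sr (Z := fun ξ t => q ξ t ^ 2)
    (J.nq.pow 2) (fun ξ t => by simp only [J.pq]) (J.sq.pow 2)
    (((J.sq.cmul 2).mul J.sy).congr (φ := fun ξ t => 2 * q ξ t * y ξ t) (fun _ _ _ _ => rfl) |>
      fun h => by simpa using h) (J.tq.pow 2) ?_
  intro ξ t a b hK hs hss
  have hf := J.f_pos ξ t a.le b
  have hg := J.g_pos ξ t a.le b
  have hle := J.f_le hi ξ t a.le b
  have hp := hB ξ t a.le b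
  beta_reduce at hs hss hK ⊢
  norm_num at hs hss ⊢
  generalize f ξ t = f at *
  generalize g ξ t = g at *
  generalize p ξ t = p at *
  generalize q ξ t = q at *
  generalize y ξ t = y at *
  generalize y1 ξ t = y1 at *
  have hB0 : 0 ≤ B := (sq_nonneg p).trans hp
  have hp0 : q ≠ 0 := by rintro rfl; norm_num at hK; linarith
  have hx : y = 0 := by
    rcases hs with h | h
    · exact absurd h hp0
    · exact h
  subst hx
  have e : 2 * q * (y1 + p * 0 / f - p ^ 2 * q / f ^ 2 - q ^ 3 / g ^ 2 + 4 * (f * p / g ^ 3)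
      + 4 * (q / g ^ 2) - 6 * (f ^ 2 * q / g ^ 4))
      = 2 * q * y1 - 2 * (((p * q * (g / f)) ^ 2 + q ^ 4 - 4 * (f / g) * (p * q) - 4 * q ^ 2
        + 6 * (f / g) ^ 2 * q ^ 2) / g ^ 2) := by
    field_simp
    ring
  have hu : f / g ≤ 1 := (div_le_one hg).2 hle
  have hu0 : 0 < f / g := div_pos hf hg
  have e2 : 0 < ((p * q * (g / f)) ^ 2 + q ^ 4 - 4 * (f / g) * (p * q) - 4 * q ^ 2
        + 6 * (f / g) ^ 2 * q ^ 2) / g ^ 2 := by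
    apply div_pos _ (by positivity)
    have h1 : 0 ≤ (p * q * (g / f)) ^ 2 := sq_nonneg _
    generalize f / g = u at *
    have h2 : u ^ 2 ≤ 1 := pow_le_one₀ hu0.le hu
    have h3 : 4 * u * (p * q) ≤ 2 * p ^ 2 + 2 * (u ^ 2 * q ^ 2) := by
      nlinarith [sq_nonneg (p - u * q)]
    have h4 : 0 ≤ u ^ 2 * q ^ 2 := by positivity
    have h5 : (7 + 2 * B) * q ^ 2 ≤ q ^ 2 * q ^ 2 := by nlinarith [sq_nonneg q]
    have h6 : 2 * B ≤ 2 * B * q ^ 2 := by nlinarith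
    nlinarith
  have hss' : 2 * q * y1 ≤ 0 := by nlinarith
  nlinarith [e]


theorem x_bd (J : Jet T ρ f g p q x y x1 y1 x2 y2 ρs) (hi : ∀ ξ, f ξ 0 ≤ g ξ 0)
    (σ : ℝ) (hσ : σ = 1 ∨ σ = -1) :
    ∃ B, ∀ ξ t, 0 ≤ t → t < T → σ * (f ξ t * x ξ t) ≤ B := by
  obtain ⟨Bp, hBp⟩ := J.p_bd hi
  obtain ⟨Bq, hBq⟩ := J.q_bd hi
  obtain ⟨V, hV⟩ := J.g_le hi
  obtain ⟨N1, hN1, hc1⟩ := boxBd (1 + |Bp| + |Bq| + |V|) (cF1 σ) (by unfold cF1; fun_prop)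
  obtain ⟨N2, hN2, hc2⟩ := boxBd (1 + |Bp| + |Bq| + |V|) (cF2 σ) (by unfold cF2; fun_prop)
  obtain ⟨N0, hN0, hc0⟩ := boxBd (1 + |Bp| + |Bq| + |V|) (cF0 σ) (by unfold cF0 cP; fun_prop)
  have hs1 : Sd T ρ (fun ξ t => σ * (f ξ t * x ξ t) + 2 * (p ξ t ^ 2 + q ξ t ^ 2))
      (fun ξ t => σ * (p ξ t * x ξ t + f ξ t * x1 ξ t) + 4 * (p ξ t * x ξ t + q ξ t * y ξ t)) :=
    (((J.sf.mul J.sx).cmul σ).add (((J.sp.pow 2).add (J.sq.pow 2)).cmul 2)).congr (by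
      intro ξ t _ _; norm_num; ring)
  have hs2 : Sd T ρ
      (fun ξ t => σ * (p ξ t * x ξ t + f ξ t * x1 ξ t) + 4 * (p ξ t * x ξ t + q ξ t * y ξ t))
      (fun ξ t => σ * (x ξ t * x ξ t + 2 * p ξ t * x1 ξ t + f ξ t * x2 ξ t)
        + 4 * (x ξ t ^ 2 + p ξ t * x1 ξ t + y ξ t ^ 2 + q ξ t * y1 ξ t)) :=
    ((((J.sp.mul J.sx).add (J.sf.mul J.sx1)).cmul σ).add
      (((J.sp.mul J.sx).add (J.sq.mul J.sy)).cmul 4)).congr (by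
      intro ξ t _ _; ring)
  have hnice : Nice T (fun ξ t => σ * (f ξ t * x ξ t) + 2 * (p ξ t ^ 2 + q ξ t ^ 2)) :=
    ContDiffOn.add (contDiffOn_const.mul (J.nf.mul J.nx))
      (contDiffOn_const.mul ((J.np.pow 2).add (J.nq.pow 2)))
  have key := maxp2 (N0 + N1 + N2 + 2 + 2 * (Bp + Bq)) J.T_pos J.r_pos J.sr hnice
    (fun ξ t => by simp only [J.pf, J.px, J.pp, J.pq]) hs1 hs2
    (((J.tf.mul J.tx).cmul σ).add (((J.tp.pow 2).add (J.tq.pow 2)).cmul 2)) ?_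
  · obtain ⟨B', hB'⟩ := key
    refine ⟨B', fun ξ t a b => ?_⟩
    have := hB' ξ t a b
    nlinarith [sq_nonneg (p ξ t), sq_nonneg (q ξ t)]
  · intro ξ t a b hK hs hss
    have hf := J.f_pos ξ t a.le b
    have hg := J.g_pos ξ t a.le b
    have hle := J.f_le hi ξ t a.le b
    have hp := hBp ξ t a.le b
    have hq := hBq ξ t a.le b
    have hv := hV ξ t a.le b
    have b1 := abs_nonneg Bp
    have b2 := abs_nonneg Bq
    have b3 := abs_nonneg V
    have hpB : |p ξ t| ≤ 1 + |Bp| + |Bq| + |V| := (absBd hp).trans (by linarith)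
    have hqB : |q ξ t| ≤ 1 + |Bp| + |Bq| + |V| := (absBd hq).trans (by linarith)
    have hu0 : 0 < f ξ t / g ξ t := div_pos hf hg
    have hu1 : f ξ t / g ξ t ≤ 1 := (div_le_one hg).2 hle
    have hv0 : 0 < g ξ t / f ξ t := div_pos hg hf
    have huB : |f ξ t / g ξ t| ≤ 1 + |Bp| + |Bq| + |V| := by rw [abs_of_pos hu0]; linarith
    have hvB : |g ξ t / f ξ t| ≤ 1 + |Bp| + |Bq| + |V| := by
      rw [abs_of_pos hv0]; linarith [le_abs_self V]
    have k1 := hc1 _ _ _ _ hpB hqB huB hvB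
    have k2 := hc2 _ _ _ _ hpB hqB huB hvB
    have k0 := hc0 _ _ _ _ hpB hqB huB hvB
    have hX : N0 + N1 + N2 + 2 ≤ |g ξ t * x ξ t| := by
      have h1 : N0 + N1 + N2 + 2 ≤ σ * (f ξ t * x ξ t) := by linarith
      have h2 : σ * (f ξ t * x ξ t) ≤ |f ξ t * x ξ t| := by
        rcases hσ with rfl | rfl
        · simpa using le_abs_self (f ξ t * x ξ t)
        · simpa using neg_le_abs (f ξ t * x ξ t)
      have h3 : |f ξ t * x ξ t| ≤ |g ξ t * x ξ t| := by
        rw [abs_mul, abs_mul, abs_of_pos hf, abs_of_pos hg]; gcongr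
      linarith
    have hneg := quadNeg (Y := g ξ t * y ξ t) (N := N0 + N1 + N2) σ hσ (by linarith)
      (k0.trans (by linarith)) (k1.trans (by linarith)) (k2.trans (by linarith)) hX
    have hdiv := div_neg_of_neg_of_pos hneg (by positivity : 0 < g ξ t ^ 2)
    refine lt_of_eq_of_lt ?_ (add_neg_of_nonpos_of_neg hss hdiv)
    beta_reduce
    rw [← algF hσ hf hg hs]
    norm_num
    ring

theorem y_bd (J : Jet T ρ f g p q x y x1 y1 x2 y2 ρs) (hi : ∀ ξ, f ξ 0 ≤ g ξ 0)
    (σ : ℝ) (hσ : σ = 1 ∨ σ = -1) :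
    ∃ B, ∀ ξ t, 0 ≤ t → t < T → σ * (g ξ t * y ξ t) ≤ B := by
  obtain ⟨Bp, hBp⟩ := J.p_bd hi
  obtain ⟨Bq, hBq⟩ := J.q_bd hi
  obtain ⟨V, hV⟩ := J.g_le hi
  obtain ⟨N1, hN1, hc1⟩ := boxBd (1 + |Bp| + |Bq| + |V|) (cG2 σ) (by unfold cG2; fun_prop)
  obtain ⟨N2, hN2, hc2⟩ := boxBd (1 + |Bp| + |Bq| + |V|) (cG1 σ) (by unfold cG1; fun_prop)
  obtain ⟨N0, hN0, hc0⟩ := boxBd (1 + |Bp| + |Bq| + |V|) (cG0 σ) (by unfold cG0 cP; fun_prop)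
  have hs1 : Sd T ρ (fun ξ t => σ * (g ξ t * y ξ t) + 2 * (p ξ t ^ 2 + q ξ t ^ 2))
      (fun ξ t => σ * (q ξ t * y ξ t + g ξ t * y1 ξ t) + 4 * (p ξ t * x ξ t + q ξ t * y ξ t)) :=
    (((J.sg.mul J.sy).cmul σ).add (((J.sp.pow 2).add (J.sq.pow 2)).cmul 2)).congr (by
      intro ξ t _ _; norm_num; ring)
  have hs2 : Sd T ρ
      (fun ξ t => σ * (q ξ t * y ξ t + g ξ t * y1 ξ t) + 4 * (p ξ t * x ξ t + q ξ t * y ξ t))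
      (fun ξ t => σ * (y ξ t * y ξ t + 2 * q ξ t * y1 ξ t + g ξ t * y2 ξ t)
        + 4 * (x ξ t ^ 2 + p ξ t * x1 ξ t + y ξ t ^ 2 + q ξ t * y1 ξ t)) :=
    ((((J.sq.mul J.sy).add (J.sg.mul J.sy1)).cmul σ).add
      (((J.sp.mul J.sx).add (J.sq.mul J.sy)).cmul 4)).congr (by
      intro ξ t _ _; ring)
  have hnice : Nice T (fun ξ t => σ * (g ξ t * y ξ t) + 2 * (p ξ t ^ 2 + q ξ t ^ 2)) :=
    ContDiffOn.add (contDiffOn_const.mul (J.ng.mul J.ny))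
      (contDiffOn_const.mul ((J.np.pow 2).add (J.nq.pow 2)))
  have key := maxp2 (N0 + N1 + N2 + 2 + 2 * (Bp + Bq)) J.T_pos J.r_pos J.sr hnice
    (fun ξ t => by simp only [J.pg, J.py, J.pp, J.pq]) hs1 hs2
    (((J.tg.mul J.ty).cmul σ).add (((J.tp.pow 2).add (J.tq.pow 2)).cmul 2)) ?_
  · obtain ⟨B', hB'⟩ := key
    refine ⟨B', fun ξ t a b => ?_⟩
    have := hB' ξ t a b
    nlinarith [sq_nonneg (p ξ t), sq_nonneg (q ξ t)]
  · intro ξ t a b hK hs hss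
    have hf := J.f_pos ξ t a.le b
    have hg := J.g_pos ξ t a.le b
    have hle := J.f_le hi ξ t a.le b
    have hp := hBp ξ t a.le b
    have hq := hBq ξ t a.le b
    have hv := hV ξ t a.le b
    have b1 := abs_nonneg Bp
    have b2 := abs_nonneg Bq
    have b3 := abs_nonneg V
    have hpB : |p ξ t| ≤ 1 + |Bp| + |Bq| + |V| := (absBd hp).trans (by linarith)
    have hqB : |q ξ t| ≤ 1 + |Bp| + |Bq| + |V| := (absBd hq).trans (by linarith)
    have hu0 : 0 < f ξ t / g ξ t := div_pos hf hg
    have hu1 : f ξ t / g ξ t ≤ 1 := (div_le_one hg).2 hle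
    have hv0 : 0 < g ξ t / f ξ t := div_pos hg hf
    have huB : |f ξ t / g ξ t| ≤ 1 + |Bp| + |Bq| + |V| := by rw [abs_of_pos hu0]; linarith
    have hvB : |g ξ t / f ξ t| ≤ 1 + |Bp| + |Bq| + |V| := by
      rw [abs_of_pos hv0]; linarith [le_abs_self V]
    have k1 := hc1 _ _ _ _ hpB hqB huB hvB
    have k2 := hc2 _ _ _ _ hpB hqB huB hvB
    have k0 := hc0 _ _ _ _ hpB hqB huB hvB
    have hX : N0 + N1 + N2 + 2 ≤ |g ξ t * y ξ t| := by
      have h1 : N0 + N1 + N2 + 2 ≤ σ * (g ξ t * y ξ t) := by linarith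
      have h2 : σ * (g ξ t * y ξ t) ≤ |g ξ t * y ξ t| := by
        rcases hσ with rfl | rfl
        · simpa using le_abs_self (g ξ t * y ξ t)
        · simpa using neg_le_abs (g ξ t * y ξ t)
      have h3 : |g ξ t * y ξ t| ≤ |g ξ t * y ξ t| := le_rfl
      linarith
    have hneg := quadNeg (Y := g ξ t * x ξ t) (N := N0 + N1 + N2) σ hσ (by linarith)
      (k0.trans (by linarith)) (k1.trans (by linarith)) (k2.trans (by linarith)) hX
    have hdiv := div_neg_of_neg_of_pos hneg (by positivity : 0 < g ξ t ^ 2)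
    refine lt_of_eq_of_lt ?_ (add_neg_of_nonpos_of_neg hss hdiv)
    beta_reduce
    rw [← algG hσ hf hg hs]
    norm_num
    ring

end Jet

theorem limSq {T C : ℝ} (hT : 0 < T) (h : ℝ → ℝ) (hpos : ∀ t, 0 ≤ t → t < T → 0 < h t)
    (hd : ∀ t, 0 < t → t < T → DifferentiableAt ℝ (fun τ => h τ ^ 2) t)
    (hC : ∀ t, 0 < t → t < T → |deriv (fun τ => h τ ^ 2) t| ≤ C) :
    ∃ L, Filter.Tendsto h (𝓝[<] T) (𝓝 L) := by
  have hC0 : 0 ≤ C := (abs_nonneg _).trans (hC (T / 2) (by linarith) (by linarith))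
  have hl : LipschitzOnWith C.toNNReal (fun τ => h τ ^ 2) (Set.Ioo 0 T) := by
    refine (convex_Ioo 0 T).lipschitzOnWith_of_nnnorm_deriv_le (fun t ht => hd t ht.1 ht.2) ?_
    intro t ht
    rw [← NNReal.coe_le_coe, Real.coe_toNNReal _ hC0]
    exact hC t ht.1 ht.2
  obtain ⟨k, hk, he⟩ := hl.extend_real
  refine ⟨Real.sqrt (k T), ?_⟩
  have h1 : Filter.Tendsto (fun t => Real.sqrt (k t)) (𝓝[<] T) (𝓝 (Real.sqrt (k T))) :=
    ((Real.continuous_sqrt.comp hk.continuous).tendsto T).mono_left nhdsWithin_le_nhds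
  refine h1.congr' ?_
  filter_upwards [Ioo_mem_nhdsLT hT] with t ht
  rw [← he ht]
  exact Real.sqrt_sq (hpos t ht.1.le ht.2).le

/-- Under Assumption A, `∂_t(f²)` and `∂_t(g²)` are uniformly bounded;
consequently, for every `ξ` the limits `lim_{t↗T} f(ξ,t)` and `lim_{t↗T} g(ξ,t)` exist,
so the solution has a well-defined profile at the singular time. -/
theorem singular_profile (T : ℝ) (f g ρ : ℝ → ℝ → ℝ)
    (sol : AssumptionA T f g ρ) :
    (∃ C : ℝ, ∀ ξ t : ℝ, 0 < t → t < T →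
      |pdt (fun x τ => (f x τ) ^ 2) ξ t| ≤ C ∧
      |pdt (fun x τ => (g x τ) ^ 2) ξ t| ≤ C) ∧
    ∀ ξ : ℝ,
      (∃ Lf : ℝ, Filter.Tendsto (fun t => f ξ t) (𝓝[<] T) (𝓝 Lf)) ∧
      (∃ Lg : ℝ, Filter.Tendsto (fun t => g ξ t) (𝓝[<] T) (𝓝 Lg)) := by
  have J := mkJet T f g ρ sol.toWarpedBerger
  have hi := sol.init_order
  obtain ⟨Bp, hBp⟩ := J.p_bd hi
  obtain ⟨Bq, hBq⟩ := J.q_bd hi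
  obtain ⟨V, hV⟩ := J.g_le hi
  obtain ⟨X1, hX1⟩ := J.x_bd hi 1 (Or.inl rfl)
  obtain ⟨X2, hX2⟩ := J.x_bd hi (-1) (Or.inr rfl)
  obtain ⟨Y1, hY1⟩ := J.y_bd hi 1 (Or.inl rfl)
  obtain ⟨Y2, hY2⟩ := J.y_bd hi (-1) (Or.inr rfl)
  obtain ⟨N1, hN1, hc1⟩ := boxBd (1 + |Bp| + |Bq| + |V|)
    (fun p q u _ => 4 * p * q * u - 4 * u ^ 4) (by fun_prop)
  obtain ⟨N2, hN2, hc2⟩ := boxBd (1 + |Bp| + |Bq| + |V|)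
    (fun p q u v => 2 * (p * v + q) * q + 4 * (u ^ 2 - 2)) (by fun_prop)
  have main : ∀ ξ t : ℝ, 0 < t → t < T →
      |pdt (fun x τ => (f x τ) ^ 2) ξ t| ≤ 2 * (|X1| + |X2|) + 2 * (|Y1| + |Y2|) + N1 + N2 ∧
      |pdt (fun x τ => (g x τ) ^ 2) ξ t| ≤ 2 * (|X1| + |X2|) + 2 * (|Y1| + |Y2|) + N1 + N2 := by
    intro ξ t a b
    have hf := J.f_pos ξ t a.le b
    have hg := J.g_pos ξ t a.le b
    have hle := J.f_le hi ξ t a.le b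
    have hp := hBp ξ t a.le b
    have hq := hBq ξ t a.le b
    have hv := hV ξ t a.le b
    have b1 := abs_nonneg Bp
    have b2 := abs_nonneg Bq
    have b3 := abs_nonneg V
    have hpB : |Ds ρ f ξ t| ≤ 1 + |Bp| + |Bq| + |V| := (absBd hp).trans (by linarith)
    have hqB : |Ds ρ g ξ t| ≤ 1 + |Bp| + |Bq| + |V| := (absBd hq).trans (by linarith)
    have hu0 : 0 < f ξ t / g ξ t := div_pos hf hg
    have hu1 : f ξ t / g ξ t ≤ 1 := (div_le_one hg).2 hle
    have hv0 : 0 < g ξ t / f ξ t := div_pos hg hf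
    have huB : |f ξ t / g ξ t| ≤ 1 + |Bp| + |Bq| + |V| := by rw [abs_of_pos hu0]; linarith
    have hvB : |g ξ t / f ξ t| ≤ 1 + |Bp| + |Bq| + |V| := by
      rw [abs_of_pos hv0]; linarith [le_abs_self V]
    have k1 := abs_le.1 (hc1 _ _ _ _ hpB hqB huB hvB)
    have k2 := abs_le.1 (hc2 _ _ _ _ hpB hqB huB hvB)
    have x1 := hX1 ξ t a.le b
    have x2 := hX2 ξ t a.le b
    have y1 := hY1 ξ t a.le b
    have y2 := hY2 ξ t a.le b
    have e1 : pdt (fun x τ => (f x τ) ^ 2) ξ t = 2 * (f ξ t * Ds ρ (Ds ρ f) ξ t)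
        + (4 * Ds ρ f ξ t * Ds ρ g ξ t * (f ξ t / g ξ t) - 4 * (f ξ t / g ξ t) ^ 4) := by
      have := ((J.tf.pow 2) ξ t a b).deriv
      unfold pdt
      rw [this]
      norm_num
      field_simp
      ring
    have e2 : pdt (fun x τ => (g x τ) ^ 2) ξ t = 2 * (g ξ t * Ds ρ (Ds ρ g) ξ t)
        + (2 * (Ds ρ f ξ t * (g ξ t / f ξ t) + Ds ρ g ξ t) * Ds ρ g ξ t
          + 4 * ((f ξ t / g ξ t) ^ 2 - 2)) := by
      have := ((J.tg.pow 2) ξ t a b).deriv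
      unfold pdt
      rw [this]
      norm_num
      field_simp
      ring
    have m1 := le_abs_self X1
    have m2 := le_abs_self X2
    have m3 := le_abs_self Y1
    have m4 := le_abs_self Y2
    have n1 := abs_nonneg X1
    have n2 := abs_nonneg X2
    have n3 := abs_nonneg Y1
    have n4 := abs_nonneg Y2
    rw [e1, e2]
    constructor
    · rw [abs_le]; constructor <;> linarith [k1.1, k1.2]
    · rw [abs_le]; constructor <;> linarith [k2.1, k2.2]
  refine ⟨⟨_, main⟩, fun ξ => ⟨?_, ?_⟩⟩
  · exact limSq J.T_pos (fun t => f ξ t) (J.f_pos ξ)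
      (fun t a b => ((J.tf.pow 2) ξ t a b).differentiableAt) (fun t a b => (main ξ t a b).1)
  · exact limSq J.T_pos (fun t => g ξ t) (J.g_pos ξ)
      (fun t a b => ((J.tg.pow 2) ξ t a b).differentiableAt) (fun t a b => (main ξ t a b).2)
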